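/- arXiv:1401.7025 — 2 statements merged into one kernel-verified Lean document; each statement's English description precedes it below -/
import Mathlib

section
/- For all real numbers u1, u2, v1, v2, the limit as δ → 0⁺ of (f(u1,v1) − f(u2,v2))(S_δ(u1 − u2) − S_δ(v1 − v2)) exists, equals (f(u1,v1) − f(u2,v2))(sgn(u1 − u2) − sgn(v1 − v2)), and is nonnegative, where f(u,v) := r(u) − w(u,v) and sgn denotes the sign function. -/
/-- The dissolution rate: `w(u,v) = 0` if `v < 0`, `min (r u) 1` if `v = 0`,
`1` if `v > 0`. -/
noncomputable def dissolutionRate (r : ℝ → ℝ) (u v : ℝ) : ℝ :=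
  if v < 0 then 0 else if v = 0 then min (r u) 1 else 1

/-- The regularized sign function `S_δ`. -/
noncomputable def Sdelta (δ x : ℝ) : ℝ :=
  if x < -δ then -1 else if x ≤ δ then x / δ else 1

theorem aux_f_mono (r : ℝ → ℝ) (h0 : ∀ u, 0 ≤ r u) (hm : Monotone r)
    {a b c d : ℝ} (hab : a ≤ b) (hcd : c ≤ d) :
    r a - dissolutionRate r a d ≤ r b - dissolutionRate r b c := by
  have h1 := hm hab
  have h2 := h0 a
  have h3 := h0 b
  unfold dissolutionRate
  rcases min_cases (r a) 1 with h | h <;> rcases min_cases (r b) 1 with h' | h' <;>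
  split_ifs <;> first | linarith | (exfalso; grind)

theorem aux_Sdelta (x : ℝ) :
    Filter.Tendsto (fun δ : ℝ => Sdelta δ x) (nhdsWithin 0 (Set.Ioi 0)) (nhds (Real.sign x)) := by
  apply tendsto_const_nhds.congr'
  rcases lt_trichotomy x 0 with h | h | h
  · filter_upwards [Ioo_mem_nhdsGT (show (0:ℝ) < -x by linarith)] with δ hδ
    rw [Real.sign_of_neg h, Sdelta, if_pos (by linarith [hδ.2])]
  · filter_upwards [self_mem_nhdsWithin] with δ hδ
    have : (0:ℝ) < δ := hδ
    subst h
    rw [Real.sign_zero, Sdelta, if_neg (by linarith), if_pos (by linarith), zero_div]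
  · filter_upwards [Ioo_mem_nhdsGT h] with δ hδ
    rw [Real.sign_of_pos h, Sdelta, if_neg (by linarith [hδ.1]), if_neg (by linarith [hδ.2])]

/-- Under assumptions (A.1)–(A.2) on `r`, with `f(u,v) = r u - w(u,v)`, the limit
as `δ → 0⁺` of `(f(u₁,v₁) - f(u₂,v₂)) * (S_δ(u₁-u₂) - S_δ(v₁-v₂))` exists, equals
`(f(u₁,v₁) - f(u₂,v₂)) * (sgn(u₁-u₂) - sgn(v₁-v₂))`, and is nonnegative. -/
theorem overallRate_sign_limit
    (r : ℝ → ℝ) (us : ℝ)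
    (hr_nonneg : ∀ u, 0 ≤ r u)
    (hr_lip : LocallyLipschitz r)
    (hus : 0 ≤ us)
    (hr_zero : ∀ u ≤ us, r u = 0)
    (hr_mono : StrictMonoOn r (Set.Ici us))
    (hr_top : Filter.Tendsto r Filter.atTop Filter.atTop)
    (u₁ u₂ v₁ v₂ : ℝ) :
    Filter.Tendsto
      (fun δ : ℝ =>
        ((r u₁ - dissolutionRate r u₁ v₁) - (r u₂ - dissolutionRate r u₂ v₂)) *
          (Sdelta δ (u₁ - u₂) - Sdelta δ (v₁ - v₂)))
      (nhdsWithin 0 (Set.Ioi 0))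
      (nhds (((r u₁ - dissolutionRate r u₁ v₁) - (r u₂ - dissolutionRate r u₂ v₂)) *
        (Real.sign (u₁ - u₂) - Real.sign (v₁ - v₂)))) ∧
    ((r u₁ - dissolutionRate r u₁ v₁) - (r u₂ - dissolutionRate r u₂ v₂)) *
        (Real.sign (u₁ - u₂) - Real.sign (v₁ - v₂)) ≥ 0 := by
  have hm : Monotone r := by
    intro a b hab
    by_cases ha : a ≤ us
    · rw [hr_zero a ha]
      exact hr_nonneg b
    · push Not at ha
      exact hr_mono.monotoneOn (Set.mem_Ici.2 ha.le) (Set.mem_Ici.2 (ha.le.trans hab)) hab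
  refine ⟨((aux_Sdelta _).sub (aux_Sdelta _)).const_mul _, ?_⟩
  have key : ∀ {a b c d : ℝ}, a ≤ b → c ≤ d →
    r a - dissolutionRate r a d ≤ r b - dissolutionRate r b c :=
    fun h h' => aux_f_mono r hr_nonneg hm h h'
  have P : ∀ {x : ℝ}, 0 < x → Real.sign x = 1 := fun h => Real.sign_of_pos h
  have N : ∀ {x : ℝ}, x < 0 → Real.sign x = -1 := fun h => Real.sign_of_neg h
  rcases lt_trichotomy u₁ u₂ with h | h | h <;> rcases lt_trichotomy v₁ v₂ with h' | h' | h'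
  · rw [N (sub_neg.2 h), N (sub_neg.2 h')]; simp
  · have := key h.le h'.ge
    rw [N (sub_neg.2 h), sub_eq_zero.2 h', Real.sign_zero]; linarith
  · have := key h.le h'.le
    rw [N (sub_neg.2 h), P (sub_pos.2 h')]; linarith
  · have := key h.ge h'.le
    rw [sub_eq_zero.2 h, Real.sign_zero, N (sub_neg.2 h')]; linarith
  · rw [sub_eq_zero.2 h, sub_eq_zero.2 h']; simp
  · have := key h.le h'.le
    rw [sub_eq_zero.2 h, Real.sign_zero, P (sub_pos.2 h')]; linarith
  · have := key h.le h'.le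
    rw [P (sub_pos.2 h), N (sub_neg.2 h')]; linarith
  · have := key h.le h'.le
    rw [P (sub_pos.2 h), sub_eq_zero.2 h', Real.sign_zero]; linarith
  · rw [P (sub_pos.2 h), P (sub_pos.2 h')]; simp
end

section
/- Let (X, μ) be a finite measure space and T > 0. For i = 1, 2, let v_i, g_i, w_i : [0,T] × X → ℝ be bounded jointly measurable functions such that for almost every x ∈ X the map t ↦ v_i(t,x) is differentiable on [0,T] with derivative ∂_t v_i(t,x) = g_i(t,x) − w_i(t,x), and such that w_i(t,x) ∈ H(v_i(t,x)) for almost every (t,x). If v_1(0,·) = v_2(0,·) almost everywhere on X, then for every t ∈ [0,T]: ∫_X |v_1(t,x) − v_2(t,x)|² dμ(x) ≤ e^t · ∫_0^t ∫_X |g_1(s,x) − g_2(s,x)|² dμ(x) ds. -/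
open MeasureTheory

/-- The Heaviside graph: `H v = {0}` if `v < 0`, `[0,1]` if `v = 0`, `{1}` if `v > 0`. -/
def Heaviside (v : ℝ) : Set ℝ :=
  if v < 0 then {0} else if v = 0 then Set.Icc 0 1 else {1}

theorem heav_mono {u v a b : ℝ} (ha : a ∈ Heaviside u) (hb : b ∈ Heaviside v) :
    0 ≤ (u - v) * (a - b) := by
  unfold Heaviside at ha hb
  split_ifs at ha hb <;> simp only [Set.mem_singleton_iff, Set.mem_Icc] at ha hb <;>
    first
    | (subst ha; subst hb; nlinarith)
    | (subst ha; obtain ⟨h1, h2⟩ := hb; rcases lt_trichotomy u 0 with h | h | h <;>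
        rcases lt_trichotomy v 0 with h' | h' | h' <;>
        first
        | exact absurd h ‹_›
        | exact absurd h' ‹_›
        | nlinarith)
    | (subst hb; obtain ⟨h1, h2⟩ := ha; rcases lt_trichotomy u 0 with h | h | h <;>
        rcases lt_trichotomy v 0 with h' | h' | h' <;>
        first
        | exact absurd h ‹_›
        | exact absurd h' ‹_›
        | nlinarith)
    | (subst_vars; simp)

theorem heav_pointwise (T M : ℝ) (a b g h w z : ℝ → ℝ)
    (hb : ∀ t ∈ Set.Icc 0 T, |g t| ≤ M ∧ |h t| ≤ M ∧ |w t| ≤ M ∧ |z t| ≤ M)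
    (hab : ∀ t ∈ Set.Icc 0 T, |a t| ≤ M ∧ |b t| ≤ M)
    (ma : Measurable a) (mb : Measurable b)
    (mg : Measurable g) (mh : Measurable h) (mw : Measurable w) (mz : Measurable z)
    (ha' : ∀ t ∈ Set.Icc 0 T, HasDerivWithinAt a (g t - w t) (Set.Icc 0 T) t)
    (hb' : ∀ t ∈ Set.Icc 0 T, HasDerivWithinAt b (h t - z t) (Set.Icc 0 T) t)
    (h1 : ∀ᵐ s ∂(volume.restrict (Set.Icc 0 T)), w s ∈ Heaviside (a s))
    (h2 : ∀ᵐ s ∂(volume.restrict (Set.Icc 0 T)), z s ∈ Heaviside (b s))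
    (h0 : a 0 = b 0) (t : ℝ) (ht : t ∈ Set.Icc 0 T) :
    |a t - b t| ^ 2 ≤ Real.exp t * ∫ s in (0:ℝ)..t, |g s - h s| ^ 2 := by
  have hsub : Set.Icc 0 t ⊆ Set.Icc 0 T := Set.Icc_subset_Icc_right ht.2
  have hsub' : Set.Ioc 0 t ⊆ Set.Icc 0 T := Set.Ioc_subset_Icc_self.trans hsub
  have hM : 0 ≤ M := (abs_nonneg _).trans (hab t ht).1
  set F' : ℝ → ℝ := fun s => -Real.exp (-s) * (a s - b s) ^ 2 +
    Real.exp (-s) * (2 * (a s - b s) * ((g s - w s) - (h s - z s))) with hF'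
  have hder : ∀ s ∈ Set.Icc 0 T, HasDerivWithinAt
      (fun s => Real.exp (-s) * (a s - b s) ^ 2) (F' s) (Set.Icc 0 T) s := by
    intro s hs
    have e1 : HasDerivWithinAt (fun s : ℝ => Real.exp (-s)) (-Real.exp (-s)) (Set.Icc 0 T) s := by
      simpa using ((hasDerivAt_neg s).exp).hasDerivWithinAt
    have e2 := (((ha' s hs).sub (hb' s hs)).pow 2)
    refine (e1.mul e2).congr_deriv ?_
    simp [hF']
  have iF : IntervalIntegrable F' volume 0 t := by
    rw [intervalIntegrable_iff_integrableOn_Ioc_of_le ht.1]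
    refine Measure.integrableOn_of_bounded (M := 1 * (2*M)^2 + 1 * (2 * (2 * M) * (4 * M))) (by simp)
      (by fun_prop) ?_
    refine (ae_restrict_mem measurableSet_Ioc).mono fun s hs => ?_
    obtain ⟨q1, q2, q3, q4⟩ := hb s (hsub' hs)
    obtain ⟨q5, q6⟩ := hab s (hsub' hs)
    have r1 : |Real.exp (-s)| ≤ 1 := by
      rw [abs_of_pos (Real.exp_pos _)]; exact Real.exp_le_one_iff.2 (by linarith [hs.1])
    have r2 : |a s - b s| ≤ 2 * M := by linarith [abs_sub (a s) (b s)]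
    have r3 : |(g s - w s) - (h s - z s)| ≤ 4 * M := by
      linarith [abs_sub (g s) (w s), abs_sub (h s) (z s), abs_sub (g s - w s) (h s - z s)]
    rw [Real.norm_eq_abs]
    refine (abs_add_le _ _).trans ?_
    rw [abs_mul, abs_neg, abs_pow, abs_mul, abs_mul, abs_mul, abs_two]
    gcongr
  have iG : IntervalIntegrable (fun s => |g s - h s| ^ 2) volume 0 t := by
    rw [intervalIntegrable_iff_integrableOn_Ioc_of_le ht.1]
    refine Measure.integrableOn_of_bounded (M := (2*M)^2) (by simp)
      (by fun_prop) ?_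
    refine (ae_restrict_mem measurableSet_Ioc).mono fun s hs => ?_
    obtain ⟨q1, q2, q3, q4⟩ := hb s (hsub' hs)
    have r2 : |g s - h s| ≤ 2 * M := by linarith [abs_sub (g s) (h s)]
    rw [Real.norm_eq_abs, abs_pow, abs_abs]
    gcongr
  have ftc := intervalIntegral.integral_eq_sub_of_hasDerivAt_of_le ht.1
    (fun s hs => ((hder s (hsub hs)).continuousWithinAt).mono hsub)
    (fun s hs => (hder s (hsub (Set.Ioo_subset_Icc_self hs))).hasDerivAt
      (Icc_mem_nhds hs.1 (hs.2.trans_le ht.2))) iF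
  have hle : ∫ s in (0:ℝ)..t, F' s ≤ ∫ s in (0:ℝ)..t, |g s - h s| ^ 2 := by
    refine intervalIntegral.integral_mono_ae_restrict ht.1 iF iG ?_
    filter_upwards [ae_restrict_of_ae_restrict_of_subset hsub h1,
      ae_restrict_of_ae_restrict_of_subset hsub h2, ae_restrict_mem measurableSet_Icc]
      with s k1 k2 hs
    have hm := heav_mono k1 k2
    have r1 : Real.exp (-s) ≤ 1 := Real.exp_le_one_iff.2 (by linarith [hs.1])
    have r0 := Real.exp_pos (-s)
    rw [sq_abs]
    calc F' s = Real.exp (-s) * (-(a s - b s) ^ 2 + 2 * (a s - b s) * (g s - h s)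
            - 2 * ((a s - b s) * (w s - z s))) := by simp only [hF']; ring
      _ ≤ Real.exp (-s) * (g s - h s) ^ 2 := by
          refine mul_le_mul_of_nonneg_left ?_ r0.le
          nlinarith [sq_nonneg ((a s - b s) - (g s - h s))]
      _ ≤ (g s - h s) ^ 2 := mul_le_of_le_one_left (sq_nonneg _) r1
  rw [ftc] at hle
  simp only [h0, sub_self, ne_eq, OfNat.ofNat_ne_zero, not_false_eq_true, zero_pow, mul_zero,
    sub_zero] at hle
  calc |a t - b t| ^ 2 = Real.exp t * (Real.exp (-t) * (a t - b t) ^ 2) := by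
        rw [← mul_assoc, ← Real.exp_add, sq_abs]; simp
    _ ≤ _ := mul_le_mul_of_nonneg_left hle (Real.exp_pos t).le

/-- L²-stability of the precipitate evolution `∂ₜ v = g - w`, `w ∈ H(v)`, with
respect to the source term `g`: if `v₁(0,·) = v₂(0,·)` a.e., then for every
`t ∈ [0,T]`,
`∫ |v₁(t) - v₂(t)|² dμ ≤ eᵗ ∫₀ᵗ ∫ |g₁(s) - g₂(s)|² dμ ds`. -/
theorem heaviside_ode_L2_stability
    {X : Type*} [MeasurableSpace X] (μ : Measure X) [IsFiniteMeasure μ]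
    (T : ℝ) (hT : 0 < T)
    (v₁ v₂ g₁ g₂ w₁ w₂ : ℝ → X → ℝ)
    (M : ℝ)
    (hbdd : ∀ t ∈ Set.Icc 0 T, ∀ x : X,
      |v₁ t x| ≤ M ∧ |v₂ t x| ≤ M ∧ |g₁ t x| ≤ M ∧ |g₂ t x| ≤ M ∧
        |w₁ t x| ≤ M ∧ |w₂ t x| ≤ M)
    (hmeas_v₁ : Measurable (fun p : ℝ × X => v₁ p.1 p.2))
    (hmeas_v₂ : Measurable (fun p : ℝ × X => v₂ p.1 p.2))
    (hmeas_g₁ : Measurable (fun p : ℝ × X => g₁ p.1 p.2))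
    (hmeas_g₂ : Measurable (fun p : ℝ × X => g₂ p.1 p.2))
    (hmeas_w₁ : Measurable (fun p : ℝ × X => w₁ p.1 p.2))
    (hmeas_w₂ : Measurable (fun p : ℝ × X => w₂ p.1 p.2))
    (hderiv₁ : ∀ᵐ x ∂μ, ∀ t ∈ Set.Icc 0 T,
      HasDerivWithinAt (fun s => v₁ s x) (g₁ t x - w₁ t x) (Set.Icc 0 T) t)
    (hderiv₂ : ∀ᵐ x ∂μ, ∀ t ∈ Set.Icc 0 T,
      HasDerivWithinAt (fun s => v₂ s x) (g₂ t x - w₂ t x) (Set.Icc 0 T) t)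
    (hH₁ : ∀ᵐ p ∂((volume.restrict (Set.Icc 0 T)).prod μ),
      w₁ p.1 p.2 ∈ Heaviside (v₁ p.1 p.2))
    (hH₂ : ∀ᵐ p ∂((volume.restrict (Set.Icc 0 T)).prod μ),
      w₂ p.1 p.2 ∈ Heaviside (v₂ p.1 p.2))
    (hinit : ∀ᵐ x ∂μ, v₁ 0 x = v₂ 0 x) :
    ∀ t ∈ Set.Icc 0 T,
      ∫ x, |v₁ t x - v₂ t x| ^ 2 ∂μ ≤
        Real.exp t * ∫ s in (0:ℝ)..t, ∫ x, |g₁ s x - g₂ s x| ^ 2 ∂μ := by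
  intro t ht
  have hsub' : Set.Ioc 0 t ⊆ Set.Icc 0 T :=
    Set.Ioc_subset_Icc_self.trans (Set.Icc_subset_Icc_right ht.2)
  have swap : ∀ p : ℝ → X → Prop,
      (∀ᵐ q ∂((volume.restrict (Set.Icc 0 T)).prod μ), p q.1 q.2) →
      ∀ᵐ x ∂μ, ∀ᵐ s ∂(volume.restrict (Set.Icc 0 T)), p s x := by
    intro p hp
    have := (Measure.measurePreserving_swap (μ := μ)
      (ν := volume.restrict (Set.Icc 0 T))).quasiMeasurePreserving.ae hp
    exact Measure.ae_ae_of_ae_prod this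
  have hpt : ∀ᵐ x ∂μ, |v₁ t x - v₂ t x| ^ 2 ≤
      Real.exp t * ∫ s in (0:ℝ)..t, |g₁ s x - g₂ s x| ^ 2 := by
    filter_upwards [hderiv₁, hderiv₂, hinit, swap (fun s x => w₁ s x ∈ Heaviside (v₁ s x)) hH₁,
      swap (fun s x => w₂ s x ∈ Heaviside (v₂ s x)) hH₂] with x d1 d2 h0 k1 k2
    have sec : ∀ f : ℝ → X → ℝ, Measurable (fun p : ℝ × X => f p.1 p.2) →
        Measurable (fun s => f s x) := fun f hf => hf.comp measurable_prodMk_right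
    exact heav_pointwise T M (fun s => v₁ s x) (fun s => v₂ s x) (fun s => g₁ s x)
      (fun s => g₂ s x) (fun s => w₁ s x) (fun s => w₂ s x)
      (fun s hs => (hbdd s hs x).2.2) (fun s hs => ⟨(hbdd s hs x).1, (hbdd s hs x).2.1⟩)
      (sec _ hmeas_v₁) (sec _ hmeas_v₂) (sec _ hmeas_g₁) (sec _ hmeas_g₂)
      (sec _ hmeas_w₁) (sec _ hmeas_w₂) d1 d2 k1 k2 h0 t ht
  have hG : Integrable (fun q : ℝ × X => |g₁ q.1 q.2 - g₂ q.1 q.2| ^ 2)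
      ((volume.restrict (Set.Ioc 0 t)).prod μ) := by
    refine Integrable.of_bound (C := (2 * M) ^ 2) (by fun_prop) ?_
    have hm : ∀ᵐ q ∂((volume.restrict (Set.Ioc 0 t)).prod μ), q.1 ∈ Set.Ioc 0 t :=
      Measure.quasiMeasurePreserving_fst.ae (ae_restrict_mem measurableSet_Ioc)
    filter_upwards [hm] with q hq
    obtain ⟨-, -, q1, q2, -, -⟩ := hbdd q.1 (hsub' hq) q.2
    have r2 : |g₁ q.1 q.2 - g₂ q.1 q.2| ≤ 2 * M := by
      linarith [abs_sub (g₁ q.1 q.2) (g₂ q.1 q.2)]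
    rw [Real.norm_eq_abs, abs_pow, abs_abs]
    gcongr
  have hsw : ∫ s in (0:ℝ)..t, ∫ x, |g₁ s x - g₂ s x| ^ 2 ∂μ =
      ∫ x, (∫ s in (0:ℝ)..t, |g₁ s x - g₂ s x| ^ 2) ∂μ := by
    simp only [intervalIntegral.integral_of_le ht.1]
    exact integral_integral_swap (f := fun s x => |g₁ s x - g₂ s x| ^ 2) hG
  rw [hsw, ← integral_const_mul]
  refine integral_mono_of_nonneg (Filter.Eventually.of_forall fun x => by positivity) ?_ hpt
  refine Integrable.const_mul ?_ _
  simp only [intervalIntegral.integral_of_le ht.1]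
  exact hG.integral_prod_right
end
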